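/- Let y be even and let x be odd with y/2 ≤ x < y − 1. (i) For every even integer d with 0 ≤ d ≤ y − x − 1 and every c ≥ 0, the multiset {1^{y−1−d}, x^d, y^c} has a standard linear realization. (ii) For all integers a ≥ 2x, b ≥ y − x − 1 and c ≥ 0, the multiset {1^a, x^b, y^c} has a linear realization. -/

import Mathlib

/-- The multiset of absolute differences of consecutive entries of a list of naturals. -/
def linDiffs (l : List ℕ) : Multiset ℕ :=
  ↑(List.zipWith (fun a b => (a - b) + (b - a)) l l.tail)

/-- `l` is a linear realization of the multiset `L`: it lists `0, …, |L|`
(each exactly once) and its consecutive absolute differences form `L`. -/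
def IsLinearRealization (L : Multiset ℕ) (l : List ℕ) : Prop :=
  l.Perm (List.range (Multiset.card L + 1)) ∧ linDiffs l = L

def HasLinearRealization (L : Multiset ℕ) : Prop :=
  ∃ l : List ℕ, IsLinearRealization L l

/-- A standard linear realization starts at `0`. -/
def HasStandardLinearRealization (L : Multiset ℕ) : Prop :=
  ∃ l : List ℕ, IsLinearRealization L l ∧ l.head? = some 0

/-- A perfect linear realization starts at `0` and ends at `v - 1 = |L|`. -/
def HasPerfectLinearRealization (L : Multiset ℕ) : Prop :=
  ∃ l : List ℕ, IsLinearRealization L l ∧ l.head? = some 0 ∧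
    l.getLast? = some (Multiset.card L)

/-- The multiset of cyclic edge-lengths `min(|gᵢ₊₁ - gᵢ|, v - |gᵢ₊₁ - gᵢ|)`
of consecutive entries of a list of naturals. -/
def cycDiffs (v : ℕ) (l : List ℕ) : Multiset ℕ :=
  ↑(List.zipWith (fun a b => min ((a - b) + (b - a)) (v - ((a - b) + (b - a)))) l l.tail)

/-- `L` is (cyclically) realizable in `K_v`: some Hamiltonian path on the vertex
set `{0, …, v-1}` has `L` as its multiset of edge-lengths. -/
def IsRealizable (v : ℕ) (L : Multiset ℕ) : Prop :=
  ∃ l : List ℕ, l.Perm (List.range v) ∧ cycDiffs v l = L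

/-- The multiset `{1^a, x^b, y^c}`. -/
def mset3 (a b c x y : ℕ) : Multiset ℕ :=
  Multiset.replicate a 1 + Multiset.replicate b x + Multiset.replicate c y

/-- With `b = q'x + r'`, `0 ≤ r' < x`: `ω(x,b) = x - 1` if `q' = 0`, `r' = 1`,
or at least one of `x`, `r'` is even; otherwise `ω(x,b) = x`. -/
def omegaBHR (x b : ℕ) : ℕ :=
  if b / x = 0 ∨ b % x = 1 ∨ Even x ∨ Even (b % x) then x - 1 else x

/-- The reduced form `ĝ = min(g, v - g)`. -/
def reducedForm (v g : ℕ) : ℕ := min g (v - g)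

/-- The function `f` of Theorem 3.7 (counterexample characterization refined). -/
def fBHR (u w : ℕ) : ℕ :=
  if Even u ∧ Even w then w - 1
  else if u = 3 ∨ (Even u ∧ ¬ Even w) then u + w - 2
  else u + w - 1

/-- A multiset `L` of size `v - 1` with elements in `{1, …, ⌊v/2⌋}` is admissible
if for every divisor `d` of `v` the number of elements of `L` divisible by `d`
is at most `v - d`. -/
def IsAdmissible (v : ℕ) (L : Multiset ℕ) : Prop :=
  Multiset.card L = v - 1 ∧ (∀ z ∈ L, 1 ≤ z ∧ z ≤ v / 2) ∧
  ∀ d : ℕ, d ∣ v → Multiset.card (L.filter (fun z => d ∣ z)) ≤ v - d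

lemma linDiffs_singleton (a : ℕ) : linDiffs [a] = 0 := rfl

lemma linDiffs_cons_cons (a b : ℕ) (l : List ℕ) :
    linDiffs (a :: b :: l) = {(a - b) + (b - a)} + linDiffs (b :: l) := rfl

lemma linDiffs_append_cons (l₁ : List ℕ) (a : ℕ) (l₂ : List ℕ) :
    linDiffs (l₁ ++ a :: l₂) = linDiffs (l₁ ++ [a]) + linDiffs (a :: l₂) := by
  induction l₁ with
  | nil => simp [linDiffs_singleton]
  | cons b l ih =>
    cases l with
    | nil => simp [linDiffs_cons_cons, linDiffs_singleton]
    | cons c l =>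
      simp only [List.cons_append, linDiffs_cons_cons] at ih ⊢
      rw [ih, add_assoc]

lemma linDiffs_append {l₁ l₂ : List ℕ} {t s : ℕ} (ht : l₁.getLast? = some t)
    (hs : l₂.head? = some s) :
    linDiffs (l₁ ++ l₂) = linDiffs l₁ + {(t - s) + (s - t)} + linDiffs l₂ := by
  obtain ⟨l₁, rfl⟩ := List.getLast?_eq_some_iff.1 ht
  obtain ⟨l₂, rfl⟩ := List.head?_eq_some_iff.1 hs
  rw [List.append_assoc, List.singleton_append, linDiffs_append_cons, linDiffs_cons_cons,
    add_assoc]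

lemma linDiffs_reverse (l : List ℕ) : linDiffs l.reverse = linDiffs l := by
  induction l with
  | nil => rfl
  | cons a l ih =>
    cases l with
    | nil => rfl
    | cons b l =>
      rw [List.reverse_cons, linDiffs_append (t := b) (s := a) (by simp) (by simp), ih,
        linDiffs_cons_cons, linDiffs_singleton, add_zero, add_comm,
        Nat.add_comm (b - a) (a - b)]

lemma linDiffs_map {f : ℕ → ℕ} {l : List ℕ}
    (hf : ∀ a ∈ l, ∀ b ∈ l, (f a - f b) + (f b - f a) = (a - b) + (b - a)) :
    linDiffs (l.map f) = linDiffs l := by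
  induction l with
  | nil => rfl
  | cons a l ih =>
    cases l with
    | nil => rfl
    | cons b l =>
      simp only [List.map_cons, linDiffs_cons_cons] at ih ⊢
      rw [ih fun u hu w hw => hf u (List.mem_cons_of_mem _ hu) w (List.mem_cons_of_mem _ hw),
        hf a (by simp) b (by simp)]

lemma card_linDiffs (l : List ℕ) : Multiset.card (linDiffs l) = l.length - 1 := by
  simp [linDiffs]

/-- Reversing the part of a path behind `t` trades the edge leaving `t` for the edge from `t` to
the last vertex. -/
lemma linDiffs_rotate (A : List ℕ) {B : List ℕ} {t s e : ℕ} (hs : B.head? = some s)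
    (he : B.getLast? = some e) :
    linDiffs (A ++ t :: B) + {(t - e) + (e - t)} =
      linDiffs (A ++ t :: B.reverse) + {(t - s) + (s - t)} := by
  have h := linDiffs_append (l₁ := A ++ [t]) (t := t) (by simp) hs
  have h' := linDiffs_append (l₁ := A ++ [t]) (l₂ := B.reverse) (t := t) (s := e) (by simp)
    (by simpa using he)
  rw [List.append_assoc, List.singleton_append] at h h'
  rw [h, h', linDiffs_reverse]
  abel

lemma card_mset3 (a b c x y : ℕ) : Multiset.card (mset3 a b c x y) = a + b + c := by
  simp [mset3]

lemma mset3_add (a b c a' b' c' x y : ℕ) :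
    mset3 a b c x y + mset3 a' b' c' x y = mset3 (a + a') (b + b') (c + c') x y := by
  simp only [mset3, Multiset.replicate_add]
  abel

lemma isLinearRealization_of_forall_mem {L : Multiset ℕ} {l : List ℕ} (hl : linDiffs l = L)
    (hmem : ∀ n ≤ Multiset.card L, n ∈ l) : IsLinearRealization L l := by
  refine ⟨?_, hl⟩
  have h0 : 0 < l.length := List.length_pos_of_mem (hmem 0 (Nat.zero_le _))
  have hc := card_linDiffs l
  rw [hl] at hc
  have hsub : (List.range (Multiset.card L + 1)).Subperm l :=
    List.subperm_of_subset List.nodup_range fun n hn =>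
      hmem n (Nat.lt_succ_iff.1 (List.mem_range.1 hn))
  exact (hsub.perm_of_length_le (by simp; omega)).symm

lemma IsLinearRealization.mem_iff {L : Multiset ℕ} {l : List ℕ} (h : IsLinearRealization L l)
    {n : ℕ} : n ∈ l ↔ n ≤ Multiset.card L := by
  rw [h.1.mem_iff, List.mem_range, Nat.lt_succ_iff]

lemma HasStandardLinearRealization.one_add {L : Multiset ℕ}
    (h : HasStandardLinearRealization L) : HasStandardLinearRealization ({1} + L) := by
  obtain ⟨l, hl, h0⟩ := h
  refine ⟨[0] ++ l.map (· + 1), isLinearRealization_of_forall_mem ?_ ?_, rfl⟩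
  · rw [linDiffs_append (t := 0) (s := 1) rfl (by simp [h0]), linDiffs_singleton,
      linDiffs_map (by intros; omega), hl.2]
    simp
  · intro n hn
    rcases n with _ | n
    · simp
    · have : n ∈ l := hl.mem_iff.2 (by simp at hn; omega)
      simpa using this

lemma HasStandardLinearRealization.add_ones {L : Multiset ℕ}
    (h : HasStandardLinearRealization L) (n : ℕ) :
    HasStandardLinearRealization (Multiset.replicate n 1 + L) := by
  induction n with
  | zero => simpa using h
  | succ n ih =>
    simpa [Multiset.replicate_succ, ← Multiset.singleton_add, add_assoc] using ih.one_add

/-- Two standard linear realizations can be glued at their first vertices. -/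
lemma HasStandardLinearRealization.add {L M : Multiset ℕ}
    (hL : HasStandardLinearRealization L) (hM : HasStandardLinearRealization M) :
    HasLinearRealization (L + M) := by
  obtain ⟨l, hl, hl0⟩ := hL
  obtain ⟨m, hm, hm0⟩ := hM
  obtain ⟨l, rfl⟩ := List.head?_eq_some_iff.1 hl0
  obtain ⟨m, rfl⟩ := List.head?_eq_some_iff.1 hm0
  set n := Multiset.card L with hn
  have h₁ : linDiffs ((l.map (n - ·)).reverse ++ [n]) = L := by
    have h := linDiffs_reverse ((0 :: l).map (n - ·))
    rw [linDiffs_map, hl.2] at h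
    · simpa using h
    · intro a ha b hb
      have := hl.mem_iff.1 ha
      have := hl.mem_iff.1 hb
      omega
  have h₂ : linDiffs (n :: m.map (n + ·)) = M := by
    have h := linDiffs_map (f := (n + ·)) (l := 0 :: m) (by intros; omega)
    rw [hm.2] at h
    simpa using h
  refine ⟨(l.map (n - ·)).reverse ++ n :: m.map (n + ·), isLinearRealization_of_forall_mem
    (by rw [linDiffs_append_cons, h₁, h₂]) fun k hk => ?_⟩
  rw [Multiset.card_add] at hk
  simp only [List.mem_append, List.mem_reverse, List.mem_map, List.mem_cons]
  rcases lt_trichotomy k n with hkn | rfl | hkn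
  · have := hl.mem_iff.2 (show n - k ≤ _ by omega)
    rcases List.mem_cons.1 this with h | h
    · omega
    · exact Or.inl ⟨_, h, by omega⟩
  · exact Or.inr (Or.inl rfl)
  · have := hm.mem_iff.2 (show k - n ≤ _ by omega)
    rcases List.mem_cons.1 this with h | h
    · omega
    · exact Or.inr (Or.inr ⟨_, h, by omega⟩)

/-- The residue class of `i` modulo `y` in `{0, …, v - 1}`, in increasing order (for `i < v`). -/
def residueColumn (y v i : ℕ) : List ℕ :=
  (List.range ((v - 1 - i) / y + 1)).map fun j => i + y * j

/-- The largest element of `residueColumn y v i`. -/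
def columnTop (y v i : ℕ) : ℕ := i + y * ((v - 1 - i) / y)

lemma residueColumn_head? (y v i : ℕ) : (residueColumn y v i).head? = some i := by
  simp [residueColumn, List.range_succ_eq_map]

lemma residueColumn_eq_append (y v i : ℕ) : residueColumn y v i =
    (List.range ((v - 1 - i) / y)).map (fun j => i + y * j) ++ [columnTop y v i] := by
  simp [residueColumn, List.range_succ, columnTop]

lemma residueColumn_getLast? (y v i : ℕ) :
    (residueColumn y v i).getLast? = some (columnTop y v i) := by
  simp [residueColumn_eq_append]

lemma linDiffs_map_range (i y n : ℕ) :
    linDiffs ((List.range (n + 1)).map fun j => i + y * j) = Multiset.replicate n y := by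
  induction n with
  | zero => rfl
  | succ n ih =>
    rw [List.range_succ, List.map_append,
      linDiffs_append (t := i + y * n) (s := i + y * (n + 1)) (by simp [List.range_succ]) rfl,
      ih, List.map_singleton, linDiffs_singleton, Multiset.replicate_succ,
      ← Multiset.singleton_add, add_zero, add_comm, mul_add]
    congr 2
    omega

lemma residueColumns_perm {y v : ℕ} (hy : 0 < y) (hyv : y ≤ v) :
    ((List.range y).flatMap (residueColumn y v)).Perm (List.range v) := by
  rw [List.perm_ext_iff_of_nodup _ List.nodup_range]
  · intro n
    simp only [List.mem_flatMap, List.mem_range, residueColumn, List.mem_map]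
    constructor
    · rintro ⟨i, hi, j, hj, rfl⟩
      have := Nat.mul_le_mul_left y (Nat.lt_succ_iff.1 hj)
      have := Nat.mul_div_le (v - 1 - i) y
      omega
    · intro hn
      refine ⟨n % y, Nat.mod_lt _ hy, n / y, ?_, Nat.mod_add_div n y⟩
      rw [Nat.lt_succ_iff, Nat.le_div_iff_mul_le hy, mul_comm]
      have := Nat.mod_add_div n y
      omega
  · rw [List.nodup_flatMap]
    constructor
    · intro i _
      refine List.nodup_range.map fun j k hjk => ?_
      exact Nat.eq_of_mul_eq_mul_left hy (Nat.add_left_cancel hjk)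
    · refine List.nodup_range.imp_of_mem fun {i k} hi hk hik n hn hn' => hik ?_
      simp only [residueColumn, List.mem_map] at hn hn'
      obtain ⟨j, -, rfl⟩ := hn
      obtain ⟨j', -, h⟩ := hn'
      have := congrArg (· % y) h
      simpa [Nat.mod_eq_of_lt (List.mem_range.1 hi), Nat.mod_eq_of_lt (List.mem_range.1 hk)]
        using this.symm

lemma columnTop_succ {y v i : ℕ} (hiy : i + 1 < y) (hyv : y ≤ v) (hi : i + 1 ≠ v % y) :
    columnTop y v (i + 1) = columnTop y v i + 1 := by
  have h : v - 1 - i = (v - 1 - (i + 1)) + 1 := by omega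
  have hd : ¬ y ∣ (v - 1 - (i + 1)) + 1 := by
    rw [← h]
    rintro ⟨k, hk⟩
    apply hi
    have hv : v = (i + 1) + y * k := by omega
    rw [hv, Nat.add_mul_mod_self_left, Nat.mod_eq_of_lt hiy]
  rw [columnTop, columnTop, h, Nat.succ_div_of_not_dvd hd]
  omega

lemma columnTop_zero {y v : ℕ} (hyv : y ≤ v) (hy : 0 < y) (hr : v % y ≠ 0) :
    columnTop y v 0 = columnTop y v (y - 1) + 1 := by
  have h : v = (v - 1) + 1 := by omega
  have hd : ¬ y ∣ (v - 1) + 1 := by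
    rw [← h]
    exact fun hd => hr (Nat.mod_eq_zero_of_dvd hd)
  have h1 : v / y = (v - 1) / y := by
    conv_lhs => rw [h]
    exact Nat.succ_div_of_not_dvd hd
  have h2 : v / y = (v - y) / y + 1 := Nat.div_eq_sub_div hy hyv
  have h3 : v - 1 - (y - 1) = v - y := by omega
  rw [columnTop, columnTop, Nat.sub_zero, ← h1, h2, h3, mul_add]
  omega

/-- `l` runs from `s` to `t` through the residue columns `σ i`, `i ∈ P`, one after the other,
using `a` differences `1`, `b` differences `x`, and otherwise differences `y`. -/
structure ColumnTrail (x y v : ℕ) (σ : ℕ → ℕ) (l P : List ℕ) (s t a b : ℕ) : Prop where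
  head : l.head? = some s
  last : l.getLast? = some t
  diffs : ∃ h, linDiffs l = mset3 a b h x y
  perm : l.Perm (P.flatMap fun i => residueColumn y v (σ i))
  length : P.length = a + b + 1

namespace ColumnTrail

variable {x y v s t s' t' a b a' b' : ℕ} {σ : ℕ → ℕ} {l l' P P' : List ℕ}

lemma up (x y v : ℕ) (σ : ℕ → ℕ) (i : ℕ) :
    ColumnTrail x y v σ (residueColumn y v (σ i)) [i] (σ i) (columnTop y v (σ i)) 0 0 where
  head := residueColumn_head? ..
  last := residueColumn_getLast? ..
  diffs := ⟨(v - 1 - σ i) / y, (linDiffs_map_range ..).trans (by simp [mset3])⟩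
  perm := by simp
  length := rfl

lemma reverse (h : ColumnTrail x y v σ l P s t a b) :
    ColumnTrail x y v σ l.reverse P t s a b where
  head := by simpa using h.last
  last := by simpa using h.head
  diffs := by simpa [linDiffs_reverse] using h.diffs
  perm := l.reverse_perm.trans h.perm
  length := h.length

lemma append_one (h : ColumnTrail x y v σ l P s t a b) (h' : ColumnTrail x y v σ l' P' s' t' a' b')
    (hts : (t - s') + (s' - t) = 1) :
    ColumnTrail x y v σ (l ++ l') (P ++ P') s t' (a + a' + 1) (b + b') where
  head := by simp [h.head]
  last := by simp [h'.last]
  diffs := by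
    obtain ⟨k, hk⟩ := h.diffs
    obtain ⟨k', hk'⟩ := h'.diffs
    refine ⟨k + k', ?_⟩
    rw [linDiffs_append h.last h'.head, hk, hk', hts]
    simp only [mset3, Multiset.replicate_add, Multiset.replicate_one]
    abel
  perm := by simpa using h.perm.append h'.perm
  length := by simp [h.length, h'.length]; omega

lemma append_x (h : ColumnTrail x y v σ l P s t a b) (h' : ColumnTrail x y v σ l' P' s' t' a' b')
    (hts : (t - s') + (s' - t) = x) :
    ColumnTrail x y v σ (l ++ l') (P ++ P') s t' (a + a') (b + b' + 1) where
  head := by simp [h.head]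
  last := by simp [h'.last]
  diffs := by
    obtain ⟨k, hk⟩ := h.diffs
    obtain ⟨k', hk'⟩ := h'.diffs
    refine ⟨k + k', ?_⟩
    rw [linDiffs_append h.last h'.head, hk, hk', hts]
    simp only [mset3, Multiset.replicate_add, Multiset.replicate_one]
    abel
  perm := by simpa using h.perm.append h'.perm
  length := by simp [h.length, h'.length]; omega

lemma perm_range (h : ColumnTrail x y v σ l P s t a b) (hy : y = a + b + 1) (hyv : y ≤ v)
    (hP : ∀ i < y, ∃ p ∈ P, σ p = i) : l.Perm (List.range v) := by
  have hsub : (List.range y).Subperm (P.map σ) :=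
    List.subperm_of_subset List.nodup_range fun i hi => by
      simpa using hP i (List.mem_range.1 hi)
  have hp := hsub.perm_of_length_le (by simp [h.length, hy])
  refine h.perm.trans (List.Perm.trans ?_ (residueColumns_perm (by omega) hyv))
  simpa [List.flatMap_map] using (hp.symm.flatMap_right (residueColumn y v))

lemma linDiffs_eq (h : ColumnTrail x y v σ l P s t a b) (hy : y = a + b + 1) (hyv : y ≤ v)
    (hP : ∀ i < y, ∃ p ∈ P, σ p = i) : linDiffs l = mset3 a b (v - y) x y := by
  obtain ⟨k, hk⟩ := h.diffs
  have hc := card_linDiffs l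
  rw [hk, card_mset3, (h.perm_range hy hyv hP).length_eq, List.length_range] at hc
  rw [hk, show k = v - y by omega]

lemma standard (h : ColumnTrail x y v σ l P 0 t a b) (hy : y = a + b + 1) (hyv : y ≤ v)
    (hP : ∀ i < y, ∃ p ∈ P, σ p = i) :
    HasStandardLinearRealization (mset3 a b (v - y) x y) := by
  refine ⟨l, ⟨?_, h.linDiffs_eq hy hyv hP⟩, h.head⟩
  rw [card_mset3, show a + b + (v - y) + 1 = v by omega]
  exact h.perm_range hy hyv hP

end ColumnTrail

/-- The labelling `σ` of the columns makes the tops of the columns labelled `2i`, `2i + 1`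
and the bottoms of those labelled `2i + 1`, `2i + 2` adjacent. -/
structure IsZigzagLabelling (y v : ℕ) (σ : ℕ → ℕ) : Prop where
  zero : σ 0 = 0
  surj : ∀ i < y, ∃ p < y, σ p = i
  dist : ∀ p q, 0 < p → p < y → 0 < q → q < y →
    (σ p - σ q) + (σ q - σ p) = (p - q) + (q - p)
  top : ∀ e, Even e → e + 1 < y →
    (columnTop y v (σ e) - columnTop y v (σ (e + 1))) +
      (columnTop y v (σ (e + 1)) - columnTop y v (σ e)) = 1

lemma isZigzagLabelling_id {y v : ℕ} (hyv : y ≤ v) (hr : Even (v % y)) :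
    IsZigzagLabelling y v id where
  zero := rfl
  surj i hi := ⟨i, hi, rfl⟩
  dist _ _ _ _ _ _ := rfl
  top e he hey := by
    have := columnTop_succ hey hyv (by rintro h; rw [← h] at hr; grind)
    simp only [id]
    omega

/-- The labelling `0, y - 1, y - 2, …, 1` of the columns. -/
def negLabel (y i : ℕ) : ℕ := if i = 0 then 0 else y - i

lemma isZigzagLabelling_negLabel {y v : ℕ} (hyv : y ≤ v) (hr : v % y ≠ 0)
    (hr' : Even y ∧ Odd (v % y) ∨ Odd y ∧ (Even (v % y) ∨ v % y = 1)) :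
    IsZigzagLabelling y v (negLabel y) where
  zero := by simp [negLabel]
  surj i hi := by
    by_cases h : i = 0
    · exact ⟨0, by omega, by simp [negLabel, h]⟩
    · exact ⟨y - i, by omega, by rw [negLabel, if_neg (by omega)]; omega⟩
  dist p q hp hpy hq hqy := by
    rw [negLabel, negLabel, if_neg hp.ne', if_neg hq.ne']
    omega
  top e he hey := by
    rw [negLabel, negLabel, if_neg (by omega : e + 1 ≠ 0)]
    split_ifs with h
    · subst h
      have := columnTop_zero hyv (by omega) hr
      simp only [zero_add]
      omega
    · have := columnTop_succ (y := y) (v := v) (i := y - (e + 1)) (by omega) hyv (by grind)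
      rw [show y - (e + 1) + 1 = y - e by omega] at this
      omega

/-- Up the column labelled `e`, down the column labelled `e + 1`. -/
def columnPair (y v : ℕ) (σ : ℕ → ℕ) (e : ℕ) : List ℕ :=
  residueColumn y v (σ e) ++ (residueColumn y v (σ (e + 1))).reverse

namespace ColumnTrail

variable {x y v s a b e : ℕ} {σ : ℕ → ℕ} {l P : List ℕ}

lemma pair (x : ℕ) (hσ : IsZigzagLabelling y v σ) (he : Even e) (hey : e + 1 < y) :
    ColumnTrail x y v σ (columnPair y v σ e) [e, e + 1] (σ e) (σ (e + 1)) 1 0 :=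
  (up x y v σ e).append_one (up x y v σ (e + 1)).reverse (hσ.top e he hey)

lemma append_pairs (hσ : IsZigzagLabelling y v σ) (h : ColumnTrail x y v σ l P s (σ e) a b)
    (he : Odd e) (n : ℕ) (hn : e + 2 * n < y) :
    ColumnTrail x y v σ (l ++ (List.range n).flatMap fun k => columnPair y v σ (e + 1 + 2 * k))
      (P ++ (List.range n).flatMap fun k => [e + 1 + 2 * k, e + 1 + 2 * k + 1]) s
      (σ (e + 2 * n)) (a + 2 * n) b := by
  induction n with
  | zero => simpa using h
  | succ n ih =>
    have hd := hσ.dist (e + 2 * n) (e + 1 + 2 * n) (by grind) (by omega) (by omega) (by omega)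
    have := (ih (by omega)).append_one
      (pair x hσ (e := e + 1 + 2 * n) (by grind) (by omega)) (by omega)
    rw [show e + 1 + 2 * n + 1 = e + 2 * (n + 1) by ring] at this
    rw [show a + 2 * (n + 1) = a + 2 * n + 1 + 1 by ring]
    simpa [List.range_succ, List.append_assoc, show e + 1 + 2 * n + 1 = e + 2 * (n + 1) by ring]
      using this

lemma append_x_pairs (hσ : IsZigzagLabelling y v σ) (h : ColumnTrail x y v σ l P s (σ e) a b)
    (he : Odd e) (hx : Odd x) (n : ℕ) (hn : e + 2 * n + x ≤ y) :
    ColumnTrail x y v σ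
      (l ++ (List.range n).flatMap fun k =>
        columnPair y v σ (e + x + 2 * k) ++ columnPair y v σ (e + 1 + 2 * k))
      (P ++ (List.range n).flatMap fun k =>
        [e + x + 2 * k, e + x + 2 * k + 1, e + 1 + 2 * k, e + 1 + 2 * k + 1]) s
      (σ (e + 2 * n)) (a + 2 * n) (b + 2 * n) := by
  induction n with
  | zero => simpa using h
  | succ n ih =>
    have := hx.pos
    have hd := hσ.dist (e + 2 * n) (e + x + 2 * n) (by grind) (by omega) (by omega) (by omega)
    have hd' := hσ.dist (e + x + 2 * n + 1) (e + 1 + 2 * n) (by omega) (by omega) (by omega)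
      (by omega)
    have := ((ih (by omega)).append_x
      (pair x hσ (e := e + x + 2 * n) (by grind) (by omega)) (by omega)).append_x
      (pair x hσ (e := e + 1 + 2 * n) (by grind) (by omega)) (by omega)
    rw [show e + 1 + 2 * n + 1 = e + 2 * (n + 1) by ring] at this
    rw [show a + 2 * (n + 1) = a + 2 * n + 1 + 1 by ring,
      show b + 2 * (n + 1) = b + 2 * n + 0 + 1 + 0 + 1 by ring]
    simpa [List.range_succ, List.append_assoc, show e + 1 + 2 * n + 1 = e + 2 * (n + 1) by ring]
      using this

end ColumnTrail

lemma IsZigzagLabelling.exists_of_forall_mem {y v : ℕ} {σ : ℕ → ℕ} {P : List ℕ}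
    (hσ : IsZigzagLabelling y v σ) (hP : ∀ i < y, i ∈ P) : ∀ i < y, ∃ p ∈ P, σ p = i := by
  intro i hi
  obtain ⟨p, hp, rfl⟩ := hσ.surj i hi
  exact ⟨p, hP p hp, rfl⟩

lemma mem_flatMap_pairs {e n i : ℕ} (h₁ : e ≤ i) (h₂ : i < e + 2 * n) :
    i ∈ (List.range n).flatMap fun k => [e + 2 * k, e + 2 * k + 1] := by
  simp only [List.mem_flatMap, List.mem_range, List.mem_cons, List.not_mem_nil, or_false]
  exact ⟨(i - e) / 2, by omega, by omega⟩

lemma IsZigzagLabelling.standard_even {x y v d : ℕ} {σ : ℕ → ℕ} (hσ : IsZigzagLabelling y v σ)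
    (hyv : y ≤ v) (hy : Even y) (hx : Odd x) (hyx : y ≤ 2 * x) (hd : Even d)
    (hdy : x + 1 + d ≤ y) :
    HasStandardLinearRealization (mset3 (y - 1 - d) d (v - y) x y) := by
  obtain ⟨m, hm⟩ : ∃ m, y = x + 1 + d + 2 * m := by
    obtain ⟨p, hp⟩ := hy; obtain ⟨q, hq⟩ := hx; obtain ⟨r, hr⟩ := hd
    exact ⟨p - q - 1 - r, by omega⟩
  obtain ⟨f, rfl⟩ := hd.exists_two_nsmul
  obtain ⟨q, hq⟩ := id hx
  simp only [smul_eq_mul] at *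
  have h₀ := ColumnTrail.pair x hσ (e := 0) (by simp) (by omega)
  rw [hσ.zero, zero_add] at h₀
  have h₁ := h₀.append_pairs hσ odd_one m (by omega)
  have h₂ := h₁.append_x_pairs hσ (by grind) hx f (by omega)
  have h₃ := h₂.append_pairs hσ (by grind) (q - f) (by omega)
  have := h₃.standard (by omega) hyv (hσ.exists_of_forall_mem ?_)
  · convert this using 2 <;> omega
  · intro i hi
    simp only [List.mem_append]
    by_cases c₁ : i < 2
    · exact Or.inl (Or.inl (Or.inl (by simp; omega)))
    by_cases c₂ : i < 2 + 2 * m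
    · exact Or.inl (Or.inl (Or.inr (mem_flatMap_pairs (by omega) (by omega))))
    by_cases c₃ : i < 2 + 2 * m + 2 * f
    · refine Or.inl (Or.inr ?_)
      simp only [List.mem_flatMap, List.mem_range, List.mem_cons, List.not_mem_nil, or_false]
      exact ⟨(i - (2 + 2 * m)) / 2, by omega, by omega⟩
    by_cases c₄ : i < 1 + 2 * m + x
    · exact Or.inr (mem_flatMap_pairs (by omega) (by omega))
    · refine Or.inl (Or.inr ?_)
      simp only [List.mem_flatMap, List.mem_range, List.mem_cons, List.not_mem_nil, or_false]
      exact ⟨(i - (1 + 2 * m + x)) / 2, by omega, by omega⟩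

lemma exists_isZigzagLabelling {y v : ℕ} (hyv : y ≤ v) (hy : Even y) :
    ∃ σ, IsZigzagLabelling y v σ := by
  rcases Nat.even_or_odd (v % y) with h | h
  · exact ⟨_, isZigzagLabelling_id hyv h⟩
  · exact ⟨_, isZigzagLabelling_negLabel hyv h.pos.ne' (Or.inl ⟨hy, h⟩)⟩

lemma mset3_zero_mid (a b x y : ℕ) : mset3 a 0 b y x = mset3 a b 0 x y := by
  simp [mset3]

lemma IsZigzagLabelling.standard_odd {x v : ℕ} {σ : ℕ → ℕ} (hσ : IsZigzagLabelling x v σ)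
    (hxv : x ≤ v) (hx : Odd x) (hx3 : 3 ≤ x) (y : ℕ) :
    HasStandardLinearRealization (mset3 (x - 1) (v - x) 0 x y) := by
  obtain ⟨q, rfl⟩ := hx
  have h₀ := ColumnTrail.pair y hσ (e := 0) (by simp) (by omega)
  rw [hσ.zero, zero_add] at h₀
  have h₁ := h₀.append_pairs hσ odd_one (q - 1) (by omega)
  have hd := hσ.dist (1 + 2 * (q - 1)) (2 * q) (by omega) (by omega) (by omega) (by omega)
  have h₂ := h₁.append_one (ColumnTrail.up _ _ _ _ (2 * q)) (by omega)
  have := h₂.standard (by omega) hxv (hσ.exists_of_forall_mem ?_)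
  · rw [← mset3_zero_mid]
    convert this using 2; omega
  · intro i hi
    simp only [List.mem_append]
    by_cases c₁ : i < 2
    · exact Or.inl (Or.inl (by simp; omega))
    by_cases c₂ : i < 2 * q
    · exact Or.inl (Or.inr (mem_flatMap_pairs (by omega) (by omega)))
    · exact Or.inr (by simp; omega)

lemma exists_descending {x v : ℕ} (hx : Odd x) (hx5 : 5 ≤ x) (hxv : x ≤ v) (hv : Even (v % x))
    (hr : v % x ≠ 0) : ∃ l : List ℕ, l.head? = some 0 ∧
      (l ++ (residueColumn x v 2).reverse ++ residueColumn x v 1).Perm (List.range v) ∧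
      linDiffs (l ++ (residueColumn x v 2).reverse ++ residueColumn x v 1) =
        Multiset.replicate (x - 1) 1 + Multiset.replicate (v - x) x := by
  have hσ := isZigzagLabelling_negLabel hxv hr (Or.inr ⟨hx, Or.inl hv⟩)
  obtain ⟨q, hq⟩ := hx
  have h₀ := ColumnTrail.pair 0 hσ (e := 0) (by simp) (by omega)
  rw [hσ.zero, zero_add] at h₀
  have h₁ := h₀.append_pairs hσ odd_one (q - 2) (by omega)
  have hd := hσ.dist (1 + 2 * (q - 2)) (2 * q - 2) (by omega) (by omega) (by omega) (by omega)
  have h₂ := h₁.append_one (ColumnTrail.up _ _ _ _ (2 * q - 2)) (by omega)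
  have ht := hσ.top (2 * q - 2) (by grind) (by omega)
  rw [show 2 * q - 2 + 1 = 2 * q - 1 by omega] at ht
  have hd' := hσ.dist (2 * q - 1) (2 * q) (by omega) (by omega) (by omega) (by omega)
  have h₃ := (h₂.append_one (ColumnTrail.up _ _ _ _ (2 * q - 1)).reverse ht).append_one
    (ColumnTrail.up _ _ _ _ (2 * q)) (by omega)
  have hP := hσ.exists_of_forall_mem (P := [0, 1] ++ ((List.range (q - 2)).flatMap fun k =>
    [1 + 1 + 2 * k, 1 + 1 + 2 * k + 1]) ++ [2 * q - 2] ++ [2 * q - 1] ++ [2 * q]) (by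
      intro i hi
      simp only [List.mem_append]
      by_cases c₁ : i < 2
      · exact Or.inl (Or.inl (Or.inl (Or.inl (by simp; omega))))
      by_cases c₂ : i < 2 * q - 2
      · exact Or.inl (Or.inl (Or.inl (Or.inr (mem_flatMap_pairs (by omega) (by omega)))))
      · simp; omega)
  have hperm := h₃.perm_range (by omega) hxv hP
  have hdiffs := h₃.linDiffs_eq (by omega) hxv hP
  have e₁ : negLabel x (2 * q - 1) = 2 := by rw [negLabel, if_neg (by omega)]; omega
  have e₂ : negLabel x (2 * q) = 1 := by rw [negLabel, if_neg (by omega)]; omega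
  rw [e₁, e₂] at hperm hdiffs
  refine ⟨_, h₂.head, hperm, hdiffs.trans ?_⟩
  rw [show 1 + 2 * (q - 2) + 0 + 1 + 0 + 1 + 0 + 1 = x - 1 by omega]
  simp [mset3]

lemma standard_of_even_mod {x v : ℕ} (hx : Odd x) (hxv : x ≤ v) (hv : Even (v % x))
    (hr : 4 ≤ v % x) (y : ℕ) : HasStandardLinearRealization (mset3 x (v - x - 1) 0 x y) := by
  have hrx : v % x < x := Nat.mod_lt _ hx.pos
  have hxv' : x < v := hxv.lt_of_ne (by rintro rfl; simp at hr)
  obtain ⟨l, hl, hperm, hdiffs⟩ := exists_descending hx (by omega) hxv hv (by omega)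
  obtain ⟨k, hk⟩ : ∃ k, (v - 1 - 2) / x = k + 1 := by
    refine Nat.exists_eq_add_of_le' ((Nat.one_le_div_iff hx.pos).2 ?_)
    have := Nat.mod_add_div v x
    have : x * 1 ≤ x * (v / x) := Nat.mul_le_mul_left x (Nat.div_pos hxv hx.pos)
    omega
  set t := columnTop x v 2 with ht
  have ht' : t = 2 + x * k + x := by rw [ht, columnTop, hk]; ring
  have htop : t = columnTop x v 1 + 1 := columnTop_succ (by omega) hxv (by omega)
  set B := ((List.range (k + 1)).map fun j => 2 + x * j).reverse ++ residueColumn x v 1 with hB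
  have hcol : l ++ (residueColumn x v 2).reverse ++ residueColumn x v 1 = l ++ t :: B := by
    simp [residueColumn_eq_append x v 2, hk, hB, ht]
  rw [hcol] at hperm hdiffs
  have hrot := linDiffs_rotate l (B := B) (t := t) (s := 2 + x * k) (e := columnTop x v 1)
    (by simp [hB, List.range_succ]) (by simp [hB, residueColumn_getLast?])
  rw [hdiffs, show t - columnTop x v 1 + (columnTop x v 1 - t) = 1 by omega,
    show t - (2 + x * k) + (2 + x * k - t) = x by omega] at hrot
  refine ⟨l ++ t :: B.reverse, ⟨?_, ?_⟩, by simp [hl]⟩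
  · rw [card_mset3, show x + (v - x - 1) + 0 + 1 = v by omega]
    exact (((B.reverse_perm).cons t).append_left l).trans hperm
  · refine add_right_cancel (b := {x}) (hrot.symm.trans ?_)
    obtain ⟨b, rfl⟩ : ∃ b, v = x + 1 + b := ⟨v - x - 1, by omega⟩
    obtain ⟨z, hz⟩ : ∃ z, x = z + 1 := ⟨x - 1, by omega⟩
    rw [mset3, show x + 1 + b - x - 1 = b by omega, show x + 1 + b - x = b + 1 by omega]
    nth_rw 3 [hz]
    rw [show x - 1 = z by omega]
    simp only [Multiset.replicate_add, Multiset.replicate_one, Multiset.replicate_zero]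
    abel

lemma standard_one_odd {x : ℕ} (hx : Odd x) (hx3 : 3 ≤ x) (b y : ℕ) :
    HasStandardLinearRealization (mset3 x b 0 x y) := by
  have hrx : b % x < x := Nat.mod_lt _ hx.pos
  have hmod : (x + b) % x = b % x := Nat.add_mod_left x b
  have key {σ : ℕ → ℕ} (hσ : IsZigzagLabelling x (x + b) σ) :
      HasStandardLinearRealization (mset3 x b 0 x y) := by
    have := (hσ.standard_odd (by omega) hx hx3 y).one_add
    obtain ⟨z, hz⟩ : ∃ z, x = z + 1 := ⟨x - 1, by omega⟩
    rw [Nat.add_sub_cancel_left, show x - 1 = z by omega] at this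
    convert this using 1
    nth_rw 1 [mset3, hz]
    rw [mset3, Multiset.replicate_succ, ← Multiset.singleton_add, add_assoc, add_assoc, add_assoc]
  rcases Nat.even_or_odd (b % x) with hr | hr
  · exact key (isZigzagLabelling_id (by omega) (by rwa [hmod]))
  by_cases hr1 : b % x = 1
  · exact key (isZigzagLabelling_negLabel (by omega) (by omega)
      (Or.inr ⟨hx, Or.inr (by omega)⟩))
  · have hr' : b % x + 1 < x := by grind
    have hmod' : (x + b + 1) % x = b % x + 1 := by
      rw [add_assoc, Nat.add_mod_left, ← Nat.mod_add_mod, Nat.mod_eq_of_lt hr']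
    have := standard_of_even_mod (v := x + b + 1) hx (by omega) (by grind) (by grind) y
    rwa [show x + b + 1 - x - 1 = b by omega] at this

/-- Let `y` be even and `x` odd with `y/2 ≤ x < y - 1`.
(i) For every even `d ≤ y - x - 1` and every `c`, the multiset
`{1^{y-1-d}, x^d, y^c}` has a standard linear realization.
(ii) If `a ≥ 2x` and `b ≥ y - x - 1` then `{1^a, x^b, y^c}` has a linear
realization. -/
theorem stmt10 (x y : ℕ) (hye : Even y) (hxo : Odd x)
    (hxy1 : y / 2 ≤ x) (hxy2 : x < y - 1) :
    (∀ d c : ℕ, Even d → d ≤ y - x - 1 →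
      HasStandardLinearRealization (mset3 (y - 1 - d) d c x y)) ∧
    (∀ a b c : ℕ, 2 * x ≤ a → y - x - 1 ≤ b →
      HasLinearRealization (mset3 a b c x y)) := by
  obtain ⟨p, rfl⟩ := id hye
  obtain ⟨q, rfl⟩ := id hxo
  have hi : ∀ d c : ℕ, Even d → d ≤ p + p - (2 * q + 1) - 1 →
      HasStandardLinearRealization (mset3 (p + p - 1 - d) d c (2 * q + 1) (p + p)) := by
    intro d c hd hdy
    obtain ⟨σ, hσ⟩ := exists_isZigzagLabelling (Nat.le_add_right (p + p) c) hye
    simpa using hσ.standard_even (by omega) hye hxo (by omega) hd (by omega)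
  refine ⟨hi, fun a b c ha hb => ?_⟩
  have h := ((standard_one_odd hxo (by omega) (b - (p + p - (2 * q + 1) - 1)) (p + p)).add_ones
    (a - 2 * (2 * q + 1))).add (hi _ c ⟨p - q - 1, by omega⟩ le_rfl)
  have h₁ : Multiset.replicate (a - 2 * (2 * q + 1)) 1 =
      mset3 (a - 2 * (2 * q + 1)) 0 0 (2 * q + 1) (p + p) := by simp [mset3]
  rw [h₁, mset3_add, mset3_add] at h
  convert h using 2 <;> omega
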